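/- Let x, y ∈ (0,1] and let f : [0,1]^2 → ℝ be twice continuously differentiable. Define E_n f(x,y) := n · Σ_{k=0}^{n} Σ_{l=0}^{n} p_{n,k}(x) p_{n,l}(y) ( sqrt(k(k-1)/(n(n-1))) - k/n ) · ∂f/∂x (k/n, l/n). Then the limit as n → ∞ of E_n f(x,y) equals -((1-x)/2) · ∂f/∂x (x,y). -/

import Mathlib

open Filter Finset

/-- Bernstein basis polynomial `p_{n,k}(x) = C(n,k) x^k (1-x)^{n-k}`. -/
noncomputable def bern (n k : ℕ) (x : ℝ) : ℝ := (n.choose k : ℝ) * x ^ k * (1 - x) ^ (n - k)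

/-- The AKR node `t_{n,k} = √(k(k-1)/(n(n-1)))`. -/
noncomputable def akrNode (n k : ℕ) : ℝ := Real.sqrt ((k * (k - 1)) / (n * (n - 1)))

/-- The unit square `[0,1]²`. -/
def unitSquare : Set (ℝ × ℝ) := Set.Icc 0 1 ×ˢ Set.Icc 0 1

/-- Partial derivative in the first variable, taken within `[0,1]`. -/
noncomputable def pderivX (f : ℝ × ℝ → ℝ) (p : ℝ × ℝ) : ℝ :=
  derivWithin (fun s => f (s, p.2)) (Set.Icc 0 1) p.1

/-- Partial derivative in the second variable, taken within `[0,1]`. -/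
noncomputable def pderivY (f : ℝ × ℝ → ℝ) (p : ℝ × ℝ) : ℝ :=
  derivWithin (fun t => f (p.1, t)) (Set.Icc 0 1) p.2

/-- The bivariate tensor-product Bernstein operator
`B_n^{[2]} f(x,y) = Σ_{k=0}^n Σ_{l=0}^n f(k/n, l/n) p_{n,k}(x) p_{n,l}(y)`. -/
noncomputable def bernstein2Op (n : ℕ) (f : ℝ × ℝ → ℝ) (x y : ℝ) : ℝ :=
  ∑ k ∈ Finset.range (n + 1), ∑ l ∈ Finset.range (n + 1),
    f ((k : ℝ) / n, (l : ℝ) / n) * bern n k x * bern n l y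

/-- The bivariate Aldaz–Kounchev–Render operator with `j = 2`:
`B_{n,2}^{[2]} f(x,y) = Σ_{k=0}^n Σ_{l=0}^n f(t_{n,k}, t_{n,l}) p_{n,k}(x) p_{n,l}(y)`. -/
noncomputable def akr2Op (n : ℕ) (f : ℝ × ℝ → ℝ) (x y : ℝ) : ℝ :=
  ∑ k ∈ Finset.range (n + 1), ∑ l ∈ Finset.range (n + 1),
    f (akrNode n k, akrNode n l) * bern n k x * bern n l y

lemma bern_nonneg {x : ℝ} (hx : x ∈ Set.Icc (0 : ℝ) 1) (n k : ℕ) : 0 ≤ bern n k x :=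
  mul_nonneg (mul_nonneg (Nat.cast_nonneg _) (pow_nonneg hx.1 _))
    (pow_nonneg (sub_nonneg.2 hx.2) _)

lemma bern_eq_eval_bernsteinPolynomial (n k : ℕ) (x : ℝ) :
    bern n k x = (bernsteinPolynomial ℝ n k).eval x := by
  simp [bern, bernsteinPolynomial]

lemma sum_bern (n : ℕ) (x : ℝ) : ∑ k ∈ range (n + 1), bern n k x = 1 := by
  have h := congrArg (Polynomial.eval x) (bernsteinPolynomial.sum ℝ n)
  simpa [Polynomial.eval_finsetSum, bern_eq_eval_bernsteinPolynomial] using h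

lemma sum_bern_mul_sq {n : ℕ} (hn : n ≠ 0) (x : ℝ) :
    ∑ k ∈ range (n + 1), bern n k x * ((k : ℝ) / n - x) ^ 2 = x * (1 - x) / n := by
  have h := congrArg (Polynomial.eval x) (bernsteinPolynomial.variance ℝ n)
  have hn' : (n : ℝ) ≠ 0 := Nat.cast_ne_zero.2 hn
  simp only [Polynomial.eval_finsetSum, Polynomial.eval_mul, Polynomial.eval_pow,
    Polynomial.eval_sub, Polynomial.eval_X, Polynomial.eval_natCast,
    Polynomial.eval_one, ← bern_eq_eval_bernsteinPolynomial, nsmul_eq_mul] at h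
  calc ∑ k ∈ range (n + 1), bern n k x * ((k : ℝ) / n - x) ^ 2
      = (∑ k ∈ range (n + 1), ((n : ℝ) * x - k) ^ 2 * bern n k x) / (n : ℝ) ^ 2 := by
        rw [sum_div]
        refine sum_congr rfl fun k _ => ?_
        field_simp
        ring
    _ = x * (1 - x) / n := by
        rw [h]
        field_simp

/-- Tensor-product Bernstein means concentrate at `(x, y)`. -/
lemma tendsto_sum_bern_mul_bern {x y : ℝ} (hx : x ∈ Set.Icc (0 : ℝ) 1)
    (hy : y ∈ Set.Icc (0 : ℝ) 1) (F : ℕ → ℕ → ℕ → ℝ) (L : ℝ)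
    (h : ∀ ε > 0, ∃ C ≥ 0, ∀ᶠ n : ℕ in atTop, ∀ k ≤ n, ∀ l ≤ n,
      |F n k l - L| ≤ ε + C * (((k : ℝ) / n - x) ^ 2 + ((l : ℝ) / n - y) ^ 2)) :
    Tendsto (fun n : ℕ => ∑ k ∈ range (n + 1), ∑ l ∈ range (n + 1),
      bern n k x * bern n l y * F n k l) atTop (nhds L) := by
  rw [Metric.tendsto_atTop']
  intro ε hε
  obtain ⟨C, hC, hF⟩ := h (ε / 2) (half_pos hε)
  have hlim : Tendsto (fun n : ℕ => 2 * C / (n : ℝ)) atTop (nhds 0) :=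
    tendsto_const_div_atTop_nhds_zero_nat _
  obtain ⟨N, hN⟩ := eventually_atTop.1
    ((hF.and (hlim.eventually_lt_const (half_pos hε))).and (eventually_gt_atTop 0))
  refine ⟨N, fun n hn => ?_⟩
  obtain ⟨⟨hFn, hCn⟩, hn0⟩ := hN n hn.le
  have hnR : (0 : ℝ) < n := Nat.cast_pos.2 hn0
  have hsplit : ∀ A : ℕ → ℕ → ℝ, (∑ k ∈ range (n + 1), ∑ l ∈ range (n + 1),
      bern n k x * bern n l y * A k l) = ∑ k ∈ range (n + 1), bern n k x *
        ∑ l ∈ range (n + 1), bern n l y * A k l := fun A =>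
    sum_congr rfl fun k _ => by
      rw [mul_sum]
      exact sum_congr rfl fun l _ => by ring
  have hconst : (∑ k ∈ range (n + 1), ∑ l ∈ range (n + 1), bern n k x * bern n l y * L) = L := by
    rw [hsplit]
    simp only [← sum_mul, sum_bern, one_mul]
  have hmaj : (∑ k ∈ range (n + 1), ∑ l ∈ range (n + 1), bern n k x * bern n l y *
      (ε / 2 + C * (((k : ℝ) / n - x) ^ 2 + ((l : ℝ) / n - y) ^ 2)))
      = ε / 2 + C * (x * (1 - x) / n + y * (1 - y) / n) := by
    rw [hsplit]
    have inner : ∀ k : ℕ, (∑ l ∈ range (n + 1), bern n l y *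
        (ε / 2 + C * (((k : ℝ) / n - x) ^ 2 + ((l : ℝ) / n - y) ^ 2)))
        = (ε / 2 + C * (y * (1 - y) / n)) + C * ((k : ℝ) / n - x) ^ 2 := by
      intro k
      calc _ = ∑ l ∈ range (n + 1), (bern n l y * (ε / 2 + C * ((k : ℝ) / n - x) ^ 2)
            + C * (bern n l y * ((l : ℝ) / n - y) ^ 2)) :=
            sum_congr rfl fun l _ => by ring
        _ = _ := by
            rw [sum_add_distrib, ← sum_mul, ← mul_sum, sum_bern, sum_bern_mul_sq hn0.ne']
            ring
    calc _ = ∑ k ∈ range (n + 1), (bern n k x * (ε / 2 + C * (y * (1 - y) / n))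
            + C * (bern n k x * ((k : ℝ) / n - x) ^ 2)) :=
            sum_congr rfl fun k _ => by rw [inner]; ring
      _ = _ := by
            rw [sum_add_distrib, ← sum_mul, ← mul_sum, sum_bern, sum_bern_mul_sq hn0.ne']
            ring
  have hvar : C * (x * (1 - x) / n + y * (1 - y) / n) ≤ 2 * C / n := by
    have h1 : x * (1 - x) ≤ 1 := by nlinarith [hx.1, hx.2]
    have h2 : y * (1 - y) ≤ 1 := by nlinarith [hy.1, hy.2]
    rw [← add_div, mul_div_assoc', div_le_div_iff_of_pos_right hnR]
    nlinarith
  rw [Real.dist_eq]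
  calc |(∑ k ∈ range (n + 1), ∑ l ∈ range (n + 1), bern n k x * bern n l y * F n k l) - L|
      = |∑ k ∈ range (n + 1), ∑ l ∈ range (n + 1),
          bern n k x * bern n l y * (F n k l - L)| := by
        nth_rewrite 1 [← hconst]
        simp only [mul_sub, sum_sub_distrib]
    _ ≤ ∑ k ∈ range (n + 1), ∑ l ∈ range (n + 1), bern n k x * bern n l y *
          (ε / 2 + C * (((k : ℝ) / n - x) ^ 2 + ((l : ℝ) / n - y) ^ 2)) := by
        refine (abs_sum_le_sum_abs _ _).trans (sum_le_sum fun k hk => ?_)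
        refine (abs_sum_le_sum_abs _ _).trans (sum_le_sum fun l hl => ?_)
        have hp : 0 ≤ bern n k x * bern n l y :=
          mul_nonneg (bern_nonneg hx _ _) (bern_nonneg hy _ _)
        rw [abs_mul, abs_of_nonneg hp]
        exact mul_le_mul_of_nonneg_left
          (hFn k (mem_range_succ_iff.1 hk) l (mem_range_succ_iff.1 hl)) hp
    _ < ε := by
        rw [hmaj]
        linarith

lemma akrNode_sq {n : ℕ} (hn : 2 ≤ n) (k : ℕ) :
    akrNode n k ^ 2 = (k * (k - 1) : ℝ) / (n * (n - 1)) := by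
  have hnR : (2 : ℝ) ≤ n := by exact_mod_cast hn
  refine Real.sq_sqrt (div_nonneg ?_ (by nlinarith))
  rcases Nat.eq_zero_or_pos k with rfl | hk
  · simp
  · have : (1 : ℝ) ≤ k := by exact_mod_cast hk
    nlinarith

/-- The rationalised form of the scaled node displacement. -/
lemma akrNode_sub_mul_add {n : ℕ} (hn : 2 ≤ n) (k : ℕ) :
    (n * (akrNode n k - (k : ℝ) / n)) * (akrNode n k + (k : ℝ) / n)
      = -((n / (n - 1) : ℝ) * ((k : ℝ) / n * (1 - (k : ℝ) / n))) := by
  have hnR : (2 : ℝ) ≤ n := by exact_mod_cast hn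
  have h1 : (n : ℝ) - 1 ≠ 0 := by linarith
  have h0 : (n : ℝ) ≠ 0 := by linarith
  calc (n * (akrNode n k - (k : ℝ) / n)) * (akrNode n k + (k : ℝ) / n)
      = n * (akrNode n k ^ 2 - ((k : ℝ) / n) ^ 2) := by ring
    _ = _ := by
      rw [akrNode_sq hn]
      field_simp
      ring

lemma div_mem_Icc_of_le {k n : ℕ} (h : k ≤ n) : (k : ℝ) / n ∈ Set.Icc (0 : ℝ) 1 :=
  ⟨by positivity, div_le_one_of_le₀ (by exact_mod_cast h) (Nat.cast_nonneg _)⟩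

lemma natCast_div_sub_one_le_two {n : ℕ} (hn : 2 ≤ n) : (n / (n - 1) : ℝ) ≤ 2 := by
  have hnR : (2 : ℝ) ≤ n := by exact_mod_cast hn
  rw [div_le_iff₀ (by linarith)]
  linarith

lemma abs_akrNode_sub_le {n k : ℕ} (hn : 2 ≤ n) (hk : k ≤ n) :
    |n * (akrNode n k - (k : ℝ) / n)| ≤ 2 := by
  have hnR : (2 : ℝ) ≤ n := by exact_mod_cast hn
  rcases Nat.eq_zero_or_pos k with rfl | hk0
  · simp [akrNode]
  have hu := div_mem_Icc_of_le hk
  have hmul := akrNode_sub_mul_add hn k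
  have hc := natCast_div_sub_one_le_two hn
  have hc0 : (0 : ℝ) ≤ n / (n - 1) := div_nonneg (by linarith) (by linarith)
  have hu0 : (0 : ℝ) < (k : ℝ) / n :=
    div_pos (Nat.cast_pos.2 hk0) (by linarith)
  have ht : 0 ≤ akrNode n k := Real.sqrt_nonneg _
  set u := (k : ℝ) / n
  set t := akrNode n k
  set w := (n : ℝ) * (t - u)
  refine le_of_mul_le_mul_right ?_ hu0
  have habs : |w| * (t + u) = (n / (n - 1) : ℝ) * (u * (1 - u)) := by
    rw [← abs_of_nonneg (by linarith : 0 ≤ t + u), ← abs_mul, hmul, abs_neg, abs_of_nonneg]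
    exact mul_nonneg hc0 (mul_nonneg hu0.le (sub_nonneg.2 hu.2))
  have h1 : |w| * u ≤ |w| * (t + u) := mul_le_mul_of_nonneg_left (by linarith) (abs_nonneg _)
  have h2 : u * (1 - u) ≤ u := by nlinarith
  calc |w| * u ≤ (n / (n - 1) : ℝ) * (u * (1 - u)) := h1.trans habs.le
    _ ≤ 2 * u := mul_le_mul hc h2 (mul_nonneg hu0.le (sub_nonneg.2 hu.2)) (by norm_num)

lemma div_mul_abs_akrNode_sub_add_le {n k : ℕ} (hn : 2 ≤ n) (hk : k ≤ n) :
    |(k : ℝ) / n * (n * (akrNode n k - (k : ℝ) / n) + (1 - (k : ℝ) / n) / 2)| ≤ 3 / n := by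
  have hnR : (2 : ℝ) ≤ n := by exact_mod_cast hn
  have hu := div_mem_Icc_of_le hk
  have hmul := akrNode_sub_mul_add hn k
  have hw := abs_akrNode_sub_le hn hk
  have hc := natCast_div_sub_one_le_two hn
  have hn0 : (n : ℝ) ≠ 0 := by linarith
  have hn1 : (n : ℝ) - 1 ≠ 0 := by linarith
  have hcc : (n / (n - 1) : ℝ) = 1 + (n / (n - 1) : ℝ) / n := by
    field_simp
    ring
  have hc0 : (0 : ℝ) ≤ n / (n - 1) := div_nonneg (by linarith) (by linarith)
  set u := (k : ℝ) / n
  set t := akrNode n k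
  set c : ℝ := n / (n - 1)
  set w := (n : ℝ) * (t - u) with hwdef
  have hid : u * (w + (1 - u) / 2) = -((c * (u * (1 - u)) + w ^ 2) / (2 * n)) := by
    have htu : u - t = -w / n := by
      rw [hwdef]
      field_simp
      ring
    have hexp : 2 * (u * (w + (1 - u) / 2)) = w * (t + u) + w * (u - t) + u * (1 - u) := by ring
    rw [hmul, htu] at hexp
    have : 2 * (u * (w + (1 - u) / 2)) = -(c / n * (u * (1 - u))) + w * (-w / n) := by
      rw [hexp]
      linear_combination -(u * (1 - u)) * hcc
    rw [eq_div_of_mul_eq two_ne_zero ((mul_comm _ _).trans this)]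
    field_simp
    ring
  have huu : 0 ≤ u * (1 - u) := mul_nonneg hu.1 (sub_nonneg.2 hu.2)
  have huu1 : u * (1 - u) ≤ 1 := by nlinarith [hu.1, hu.2]
  have hw2 : w ^ 2 ≤ 4 := by
    nlinarith [sq_abs w, abs_nonneg w]
  have hnum : 0 ≤ c * (u * (1 - u)) + w ^ 2 := by positivity
  rw [hid, abs_neg, abs_of_nonneg (div_nonneg hnum (by linarith)),
    div_le_div_iff₀ (by linarith) (by linarith)]
  nlinarith [mul_le_mul hc huu1 huu zero_le_two]

/-- The scaled node displacement is close to `-(1 - x) / 2` when `k / n` is close to `x`. -/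
lemma mul_abs_akrNode_sub_add_le {x : ℝ} (hx : x ∈ Set.Icc (0 : ℝ) 1) {n k : ℕ} (hn : 2 ≤ n)
    (hk : k ≤ n) :
    x * |n * (akrNode n k - (k : ℝ) / n) + (1 - x) / 2| ≤ 3 / n + 3 * |(k : ℝ) / n - x| := by
  have hu := div_mem_Icc_of_le hk
  have hw := abs_akrNode_sub_le hn hk
  have h1 := div_mul_abs_akrNode_sub_add_le hn hk
  set u := (k : ℝ) / n
  set w := (n : ℝ) * (akrNode n k - u)
  have hid : x * (w + (1 - x) / 2)
      = u * (w + (1 - u) / 2) + (u - x) * (u / 2 - (w + (1 - x) / 2)) := by ring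
  have hb : |u / 2 - (w + (1 - x) / 2)| ≤ 3 := by
    obtain ⟨ha, hb⟩ := abs_le.1 hw
    rw [abs_le]
    constructor <;> linarith [hu.1, hu.2, hx.1, hx.2]
  calc x * |w + (1 - x) / 2| = |x * (w + (1 - x) / 2)| := by rw [abs_mul, abs_of_nonneg hx.1]
    _ ≤ |u * (w + (1 - u) / 2)| + |u - x| * |u / 2 - (w + (1 - x) / 2)| := by
        rw [hid, ← abs_mul]
        exact abs_add_le _ _
    _ ≤ 3 / n + 3 * |u - x| := by nlinarith [abs_nonneg (u - x)]

lemma continuousOn_pderivX {f : ℝ × ℝ → ℝ} (hf : ContDiffOn ℝ 2 f unitSquare) :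
    ContinuousOn (pderivX f) unitSquare := by
  have huniq : UniqueDiffOn ℝ unitSquare :=
    (uniqueDiffOn_Icc zero_lt_one).prod (uniqueDiffOn_Icc zero_lt_one)
  have hcont : ContinuousOn (fun p => fderivWithin ℝ f unitSquare p (1, 0)) unitSquare :=
    (hf.continuousOn_fderivWithin huniq (by norm_num)).clm_apply continuousOn_const
  refine hcont.congr fun p hp => ?_
  have hline : HasDerivWithinAt (fun s : ℝ => (s, p.2)) ((1 : ℝ), (0 : ℝ)) (Set.Icc 0 1) p.1 :=
    (hasDerivWithinAt_id _ _).prodMk (hasDerivWithinAt_const _ _ _)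
  have hd : HasFDerivWithinAt f (fderivWithin ℝ f unitSquare p) unitSquare (p.1, p.2) :=
    ((hf.differentiableOn (by norm_num)) p hp).hasFDerivWithinAt
  have hmaps : Set.MapsTo (fun s : ℝ => (s, p.2)) (Set.Icc 0 1) unitSquare :=
    fun s hs => ⟨hs, hp.2⟩
  exact (hd.comp_hasDerivWithinAt p.1 hline hmaps).derivWithin
    (uniqueDiffOn_Icc zero_lt_one p.1 hp.1)

/-- A function continuous on the unit square has a quadratic modulus of continuity up to `ε`. -/
lemma exists_abs_sub_le_add_mul_sq {g : ℝ × ℝ → ℝ} {x y M : ℝ}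
    (hg : ContinuousWithinAt g unitSquare (x, y)) (hxy : (x, y) ∈ unitSquare)
    (hM : ∀ p ∈ unitSquare, |g p| ≤ M) {ε : ℝ} (hε : 0 < ε) :
    ∃ C ≥ 0, ∀ u v : ℝ, (u, v) ∈ unitSquare →
      |g (u, v) - g (x, y)| ≤ ε + C * ((u - x) ^ 2 + (v - y) ^ 2) := by
  obtain ⟨δ, hδ, h⟩ := Metric.continuousWithinAt_iff.1 hg ε hε
  have hM0 : 0 ≤ M := (abs_nonneg _).trans (hM _ hxy)
  refine ⟨2 * M / δ ^ 2, by positivity, fun u v huv => ?_⟩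
  by_cases hd : dist (u, v) (x, y) < δ
  · have hlt := h huv hd
    rw [Real.dist_eq] at hlt
    have : 0 ≤ 2 * M / δ ^ 2 * ((u - x) ^ 2 + (v - y) ^ 2) := by positivity
    linarith
  · have hsq : δ ^ 2 ≤ (u - x) ^ 2 + (v - y) ^ 2 := by
      rw [not_lt, Prod.dist_eq, le_max_iff, Real.dist_eq, Real.dist_eq] at hd
      rcases hd with hd | hd
      · have := pow_le_pow_left₀ hδ.le hd 2
        rw [sq_abs] at this
        nlinarith [sq_nonneg (v - y)]
      · have := pow_le_pow_left₀ hδ.le hd 2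
        rw [sq_abs] at this
        nlinarith [sq_nonneg (u - x)]
    have h2 : 2 * M ≤ 2 * M / δ ^ 2 * ((u - x) ^ 2 + (v - y) ^ 2) := by
      rw [div_mul_eq_mul_div, le_div_iff₀ (by positivity)]
      exact mul_le_mul_of_nonneg_left hsq (by positivity)
    have h3 := (abs_sub (g (u, v)) (g (x, y))).trans (add_le_add (hM _ huv) (hM _ hxy))
    linarith

theorem stmt_9 (x y : ℝ) (hx : x ∈ Set.Ioc (0 : ℝ) 1) (hy : y ∈ Set.Ioc (0 : ℝ) 1)
    (f : ℝ × ℝ → ℝ) (hf : ContDiffOn ℝ 2 f unitSquare) :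
    Tendsto (fun n : ℕ => (n : ℝ) * ∑ k ∈ Finset.range (n + 1), ∑ l ∈ Finset.range (n + 1),
        bern n k x * bern n l y * (akrNode n k - (k : ℝ) / n) * pderivX f ((k : ℝ) / n, (l : ℝ) / n))
      atTop (nhds (-((1 - x) / 2) * pderivX f (x, y))) := by
  have hx' : x ∈ Set.Icc (0 : ℝ) 1 := Set.Ioc_subset_Icc_self hx
  have hy' : y ∈ Set.Icc (0 : ℝ) 1 := Set.Ioc_subset_Icc_self hy
  have hg := continuousOn_pderivX hf
  set g := pderivX f
  have hxy : (x, y) ∈ unitSquare := ⟨hx', hy'⟩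
  have hcompact : IsCompact unitSquare := isCompact_Icc.prod isCompact_Icc
  obtain ⟨M, hM⟩ := hcompact.exists_bound_of_continuousOn hg
  simp only [Real.norm_eq_abs] at hM
  have hM0 : 0 ≤ M := (abs_nonneg _).trans (hM _ hxy)
  have key := tendsto_sum_bern_mul_bern hx' hy'
    (fun n k l => (n * (akrNode n k - (k : ℝ) / n)) * g ((k : ℝ) / n, (l : ℝ) / n))
    (-((1 - x) / 2) * g (x, y)) ?_
  · refine key.congr fun n => ?_
    simp only [mul_sum]
    exact sum_congr rfl fun k _ => sum_congr rfl fun l _ => by ring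
  intro ε hε
  obtain ⟨C, hC, hCg⟩ := exists_abs_sub_le_add_mul_sq (hg _ hxy) hxy hM
    (by linarith : 0 < ε / 2)
  -- `K` controls the node displacement, `η` splits `|u - x| ≤ η + (u - x) ^ 2 / η`.
  set K := 3 * M / x with hK
  have hK0 : 0 ≤ K := div_nonneg (by linarith) hx.1.le
  obtain ⟨η, hη, hKη⟩ : ∃ η > 0, K * η ≤ ε / 4 := by
    refine ⟨ε / (4 * (K + 1)), by positivity, ?_⟩
    rw [mul_div_assoc', div_le_div_iff₀ (by positivity) (by norm_num)]
    nlinarith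
  have hlim : Tendsto (fun n : ℕ => K / (n : ℝ)) atTop (nhds 0) :=
    tendsto_const_div_atTop_nhds_zero_nat _
  refine ⟨C + K / η, by positivity, ?_⟩
  filter_upwards [eventually_ge_atTop 2,
    hlim.eventually_lt_const (by linarith : 0 < ε / 4)] with n hn hKn k hk l hl
  have hnode := mul_abs_akrNode_sub_add_le hx' hn hk
  have huv : ((k : ℝ) / n, (l : ℝ) / n) ∈ unitSquare :=
    ⟨div_mem_Icc_of_le hk, div_mem_Icc_of_le hl⟩
  have hgd := hCg _ _ huv
  have hgM := hM _ huv
  set u := (k : ℝ) / n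
  set v := (l : ℝ) / n
  set w := (n : ℝ) * (akrNode n k - u)
  have habs : |u - x| ≤ η + (u - x) ^ 2 / η := by
    rw [← sub_le_iff_le_add', le_div_iff₀ hη]
    nlinarith [sq_abs (u - x), sq_nonneg (|u - x| - η), abs_nonneg (u - x)]
  have hfirst : |w + (1 - x) / 2| * M ≤ ε / 2 + K / η * (u - x) ^ 2 := by
    calc |w + (1 - x) / 2| * M ≤ ((3 / n + 3 * |u - x|) / x) * M :=
          mul_le_mul_of_nonneg_right ((le_div_iff₀' hx.1).2 hnode) hM0
      _ = K / n + K * |u - x| := by rw [hK]; ring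
      _ ≤ K / n + K * (η + (u - x) ^ 2 / η) := by gcongr
      _ = K / n + K * η + K / η * (u - x) ^ 2 := by ring
      _ ≤ ε / 2 + K / η * (u - x) ^ 2 := by linarith
  have hhalf : |(1 - x) / 2| ≤ 1 := by
    rw [abs_le]
    constructor <;> linarith [hx.1, hx.2]
  calc |w * g (u, v) - -((1 - x) / 2) * g (x, y)|
      = |(w + (1 - x) / 2) * g (u, v) - (1 - x) / 2 * (g (u, v) - g (x, y))| := by
        congr 1
        ring
    _ ≤ |w + (1 - x) / 2| * |g (u, v)| + |(1 - x) / 2| * |g (u, v) - g (x, y)| := by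
        rw [← abs_mul, ← abs_mul]
        exact abs_sub _ _
    _ ≤ |w + (1 - x) / 2| * M + 1 * |g (u, v) - g (x, y)| := by gcongr
    _ ≤ ε + (C + K / η) * ((u - x) ^ 2 + (v - y) ^ 2) := by
        have : 0 ≤ K / η * (v - y) ^ 2 := by positivity
        linarith
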